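/- Let n ≥ 1, s ≥ 1, and s₁, s₂ > 0 with 1 ≤ s₁ < n/2 + 1 and s₁ + s₂ = s + n/2 + 1. There exists a constant c > 0 (depending only on n, s, s₁, s₂) such that for all Schwartz vector fields u, B : ℝⁿ → ℝⁿ, ‖Λ^s[(u·∇)B] − (u·∇)(Λ^s B)‖_{L²} ≤ c·( ‖u‖_{Ḣ^{s₁}}·‖B‖_{Ḣ^{s₂}} + ‖u‖_{Ḣ^{s₂}}·‖B‖_{Ḣ^{s₁}} ). -/

import Mathlib

open MeasureTheory Filter SchwartzMap
open scoped FourierTransform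

noncomputable section

abbrev Ell (n : ℕ) := EuclideanSpace ℝ (Fin n)

def eVec (n : ℕ) (i : Fin n) : Ell n := EuclideanSpace.single i 1

/-- coercion of a real-valued function to a complex-valued one -/
def cf {n : ℕ} (f : Ell n → ℝ) : Ell n → ℂ := fun x => (f x : ℂ)

/-- the Fourier multiplier operator `Λ^s` with symbol `|ξ|^s` -/
def Lam {n : ℕ} (s : ℝ) (f : Ell n → ℂ) : Ell n → ℂ :=
  𝓕⁻ (fun ξ => ((‖ξ‖ ^ s : ℝ) : ℂ) * 𝓕 f ξ)

/-- the partial derivative `∂ᵢ` -/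
def pd {n : ℕ} (i : Fin n) (f : Ell n → ℂ) : Ell n → ℂ :=
  fun x => fderiv ℝ f x (eVec n i)

/-- the advection term `(v·∇)w` for complex vector fields -/
def adv {n : ℕ} (v w : Fin n → Ell n → ℂ) : Fin n → Ell n → ℂ :=
  fun l x => ∑ i, v i x * pd i (w l) x

/-- squared homogeneous Sobolev norm of a complex scalar function -/
def HsqC {n : ℕ} (s : ℝ) (f : Ell n → ℂ) : ℝ :=
  ∫ ξ, ‖ξ‖ ^ (2 * s) * ‖𝓕 f ξ‖ ^ 2

/-- homogeneous Sobolev norm `‖u‖_{Ḣ^s}` of a real vector field -/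
def Hnorm {n : ℕ} (s : ℝ) (u : Fin n → Ell n → ℝ) : ℝ :=
  Real.sqrt (∑ l, HsqC s (cf (u l)))

/-- `L²` norm of a complex vector field -/
def vL2 {n : ℕ} (f : Fin n → Ell n → ℂ) : ℝ :=
  Real.sqrt (∑ l, ∫ x, ‖f l x‖ ^ 2)

/-- `L²` pairing `⟨f,g⟩ = Σ_l ∫ f_l g_l` of complex vector fields -/
def Cinner {n : ℕ} (f g : Fin n → Ell n → ℂ) : ℂ :=
  ∑ l, ∫ x, f l x * g l x

section WeightedConvolution

variable {E : Type*} [NormedAddCommGroup E] [NormedSpace ℝ E] [FiniteDimensional ℝ E]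
  [MeasurableSpace E] [BorelSpace E] (μ : Measure E) [μ.IsAddHaarMeasure]

/-- The Cauchy–Schwarz inequality for lower integrals. -/
theorem lintegral_mul_sq_le {α : Type*} [MeasurableSpace α] {ν : Measure α}
    {f g : α → ENNReal} (hf : AEMeasurable f ν) (hg : AEMeasurable g ν) :
    (∫⁻ x, f x * g x ∂ν) ^ 2 ≤ (∫⁻ x, f x ^ 2 ∂ν) * ∫⁻ x, g x ^ 2 ∂ν := by
  have h := ENNReal.lintegral_mul_le_Lp_mul_Lq ν Real.HolderConjugate.two_two hf hg
  calc (∫⁻ x, f x * g x ∂ν) ^ 2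
      ≤ ((∫⁻ x, f x ^ (2 : ℝ) ∂ν) ^ (1 / (2 : ℝ)) * (∫⁻ x, g x ^ (2 : ℝ) ∂ν) ^ (1 / (2 : ℝ))) ^ 2 := by
        gcongr
        simpa using h
    _ = _ := by
        rw [mul_pow, ← ENNReal.rpow_natCast, ← ENNReal.rpow_natCast, ← ENNReal.rpow_mul,
          ← ENNReal.rpow_mul]
        simp

theorem ENNReal.add_sq_le_two_mul (a b : ENNReal) : (a + b) ^ 2 ≤ 2 * (a ^ 2 + b ^ 2) := by
  have h := ENNReal.rpow_add_le_mul_rpow_add_rpow a b (p := 2) (by norm_num)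
  norm_num at h
  exact_mod_cast h

/-- Integral of a radial power over a ball. -/
theorem exists_lintegral_norm_rpow_ball_le {p : ℝ} [Nontrivial E]
    (hp : p < Module.finrank ℝ E) :
    ∃ C : ℝ, 0 ≤ C ∧ ∀ R : ℝ, 0 ≤ R →
      ∫⁻ x in Metric.ball (0 : E) R, ENNReal.ofReal (‖x‖ ^ (-p)) ∂μ
        ≤ ENNReal.ofReal (C * R ^ ((Module.finrank ℝ E : ℝ) - p)) := by
  have hd : 1 ≤ Module.finrank ℝ E := Module.finrank_pos
  refine ⟨Module.finrank ℝ E * μ.real (Metric.ball 0 1) / (Module.finrank ℝ E - p),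
    div_nonneg (by positivity) (by linarith), fun R hR => le_of_eq ?_⟩
  have hintg : IntegrableOn (fun x : E => ‖x‖ ^ (-p)) (Metric.ball 0 R) μ := by
    refine integrableOn_ball_of_norm_le_rpow (C := 1) hd hp (ae_of_all _ fun x => ?_) ?_
    · rw [Real.norm_of_nonneg (by positivity), one_mul]
    · exact (by fun_prop : Measurable fun x : E => ‖x‖ ^ (-p)).aestronglyMeasurable
  rw [← ofReal_integral_eq_lintegral_ofReal hintg (ae_of_all _ fun x => by positivity)]
  congr 1
  have h1 : ∫ x in Metric.ball (0 : E) R, ‖x‖ ^ (-p) ∂μ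
      = ∫ x, (Set.Iio R).indicator (fun y : ℝ => y ^ (-p)) ‖x‖ ∂μ := by
    rw [← integral_indicator measurableSet_ball]
    congr 1 with x
    simp [Set.indicator]
  have h2 : ∫ y in Set.Ioi (0 : ℝ), y ^ (Module.finrank ℝ E - 1) •
      (Set.Iio R).indicator (fun y : ℝ => y ^ (-p)) y
      = ∫ y in (0 : ℝ)..R, y ^ ((Module.finrank ℝ E : ℝ) - 1 - p) := by
    rw [intervalIntegral.integral_of_le hR, integral_Ioc_eq_integral_Ioo,
      ← integral_indicator measurableSet_Ioi, ← integral_indicator measurableSet_Ioo]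
    congr 1 with y
    by_cases h0 : 0 < y <;> by_cases h1 : y < R <;> simp [h0, h1]
    rw [← Real.rpow_natCast, ← Real.rpow_add h0]
    congr 1
    push_cast [hd]
    ring
  rw [h1, integral_fun_norm_addHaar, h2, integral_rpow (Or.inl (by linarith)),
    Real.zero_rpow (by linarith)]
  simp only [nsmul_eq_mul, smul_eq_mul]
  rw [show (Module.finrank ℝ E : ℝ) - 1 - p + 1 = Module.finrank ℝ E - p by ring]
  ring

/-- The integral of a convolution is the product of the integrals. -/
theorem lintegral_lintegral_mul_sub {F G : E → ENNReal} (hF : Measurable F) (hG : Measurable G) :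
    ∫⁻ ξ, ∫⁻ η, F (ξ - η) * G η ∂μ ∂μ = (∫⁻ x, F x ∂μ) * ∫⁻ x, G x ∂μ := by
  rw [lintegral_lintegral_swap (by fun_prop)]
  have h : ∀ η, ∫⁻ ξ, F (ξ - η) * G η ∂μ = (∫⁻ x, F x ∂μ) * G η := fun η => by
    rw [lintegral_mul_const _ (by fun_prop), lintegral_sub_right_eq_self F η]
  simp_rw [h]
  rw [lintegral_const_mul _ hG]

/-- The part of a weighted convolution in which the output frequency dominates. -/
theorem exists_lintegral_sq_lowHigh_le [Nontrivial E] {a b : ℝ}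
    (ha : 2 * a < Module.finrank ℝ E) (hab : 2 * a + 2 * b = Module.finrank ℝ E) :
    ∃ C : ℝ, 0 ≤ C ∧ ∀ F G : E → ENNReal, Measurable F → Measurable G →
      ∫⁻ ξ, (∫⁻ η, F (ξ - η) * G η *
        ({η | ‖ξ - η‖ ≤ ‖η‖ ∧ ‖η‖ ≤ 2 * ‖ξ‖}.indicator
          (fun η => ENNReal.ofReal (‖ξ - η‖ ^ (-a) * ‖η‖ ^ (-b))) η) ∂μ) ^ 2 ∂μ
      ≤ ENNReal.ofReal C * ((∫⁻ x, F x ^ 2 ∂μ) * ∫⁻ x, G x ^ 2 ∂μ) := by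
  obtain ⟨C, hC, hCR⟩ := exists_lintegral_norm_rpow_ball_le μ (p := 2 * a) ha
  refine ⟨C * 3 ^ (Module.finrank ℝ E - 2 * a) * 2 ^ (2 * b), by positivity,
    fun F G hF hG => ?_⟩
  have hms : ∀ ξ : E, MeasurableSet {η : E | ‖ξ - η‖ ≤ ‖η‖ ∧ ‖η‖ ≤ 2 * ‖ξ‖} := fun ξ =>
    (measurableSet_le (f := fun η => ‖ξ - η‖) (g := fun η => ‖η‖) (by fun_prop) (by fun_prop)).inter
      (measurableSet_le (f := fun η : E => ‖η‖) (g := fun _ => 2 * ‖ξ‖) (by fun_prop) (by fun_prop))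
  have hker : ∀ ξ : E, ξ ≠ 0 →
      ∫⁻ η, ({η | ‖ξ - η‖ ≤ ‖η‖ ∧ ‖η‖ ≤ 2 * ‖ξ‖}.indicator
          (fun η => ENNReal.ofReal (‖ξ - η‖ ^ (-a) * ‖η‖ ^ (-b))) η) ^ 2 ∂μ
        ≤ ENNReal.ofReal (C * 3 ^ (Module.finrank ℝ E - 2 * a) * 2 ^ (2 * b)) := by
    intro ξ hξ
    have hξ' : 0 < ‖ξ‖ := norm_pos_iff.2 hξ
    calc _ ≤ ∫⁻ η, (Metric.ball (0 : E) (3 * ‖ξ‖)).indicator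
            (fun ζ => ENNReal.ofReal ((‖ξ‖ / 2) ^ (-(2 * b))) * ENNReal.ofReal (‖ζ‖ ^ (-(2 * a))))
              (ξ - η) ∂μ := by
          refine lintegral_mono fun η => ?_
          by_cases h : ‖ξ - η‖ ≤ ‖η‖ ∧ ‖η‖ ≤ 2 * ‖ξ‖
          · have hmem : ξ - η ∈ Metric.ball (0 : E) (3 * ‖ξ‖) := by
              rw [mem_ball_zero_iff]; linarith
            have hη : ‖ξ‖ / 2 ≤ ‖η‖ := by
              have : ‖ξ‖ ≤ ‖ξ - η‖ + ‖η‖ := by simpa using norm_add_le (ξ - η) η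
              linarith
            rw [Set.indicator_of_mem hmem, Set.indicator_of_mem (by exact h),
              ← ENNReal.ofReal_pow (by positivity), ← ENNReal.ofReal_mul (by positivity)]
            apply ENNReal.ofReal_le_ofReal
            rw [mul_pow, ← Real.rpow_mul_natCast (norm_nonneg _),
              ← Real.rpow_mul_natCast (norm_nonneg _), mul_comm]
            rw [show -a * (2 : ℕ) = -(2 * a) by push_cast; ring,
              show -b * (2 : ℕ) = -(2 * b) by push_cast; ring]
            gcongr ?_ * _
            exact Real.rpow_le_rpow_of_nonpos (by positivity) hη (by linarith)
          · rw [Set.indicator_of_notMem (by exact h)]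
            simp
      _ = ENNReal.ofReal ((‖ξ‖ / 2) ^ (-(2 * b))) *
            ∫⁻ ζ in Metric.ball (0 : E) (3 * ‖ξ‖), ENNReal.ofReal (‖ζ‖ ^ (-(2 * a))) ∂μ := by
          rw [lintegral_sub_left_eq_self, lintegral_indicator measurableSet_ball,
            lintegral_const_mul _ (by fun_prop)]
      _ ≤ ENNReal.ofReal ((‖ξ‖ / 2) ^ (-(2 * b))) *
            ENNReal.ofReal (C * (3 * ‖ξ‖) ^ ((Module.finrank ℝ E : ℝ) - 2 * a)) := by
          gcongr
          exact hCR _ (by positivity)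
      _ = _ := by
          rw [← ENNReal.ofReal_mul (by positivity)]
          congr 1
          rw [Real.mul_rpow (by norm_num) hξ'.le, Real.div_rpow hξ'.le (by norm_num),
            Real.rpow_neg (by norm_num : (0:ℝ) ≤ 2), Real.rpow_neg hξ'.le,
            show (Module.finrank ℝ E : ℝ) - 2 * a = 2 * b by linarith]
          have : ‖ξ‖ ^ (2 * b) ≠ 0 := (Real.rpow_pos_of_pos hξ' _).ne'
          field_simp
  have hae : ∀ᵐ ξ ∂μ, ξ ≠ 0 := by
    simp [ae_iff]
  calc _ ≤ ∫⁻ ξ, ENNReal.ofReal (C * 3 ^ (Module.finrank ℝ E - 2 * a) * 2 ^ (2 * b)) *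
            ∫⁻ η, F (ξ - η) ^ 2 * G η ^ 2 ∂μ ∂μ := by
        refine lintegral_mono_ae ?_
        filter_upwards [hae] with ξ hξ
        refine (lintegral_mul_sq_le (by fun_prop) ?_).trans ?_
        · exact ((by fun_prop : Measurable fun η : E =>
            ENNReal.ofReal (‖ξ - η‖ ^ (-a) * ‖η‖ ^ (-b))).indicator (hms ξ)).aemeasurable
        · rw [mul_comm]
          simp_rw [mul_pow]
          gcongr
          exact hker ξ hξ
    _ = _ := by
        rw [lintegral_const_mul' _ _ ENNReal.ofReal_ne_top,
          lintegral_lintegral_mul_sub μ (hF.pow_const 2) (hG.pow_const 2)]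

/-- The part of a weighted convolution in which both input frequencies dominate. -/
theorem exists_lintegral_sq_highHigh_le :
    ∃ C : ℝ, 0 ≤ C ∧ ∀ F G : E → ENNReal, Measurable F → Measurable G →
      ∫⁻ ξ, (∫⁻ η, ({ζ | ‖ξ‖ < ‖ζ‖}.indicator
            (fun ζ => F ζ * ENNReal.ofReal (‖ζ‖ ^ (-(Module.finrank ℝ E : ℝ) / 4))) (ξ - η)) *
        ({η | ‖ξ‖ < ‖η‖}.indicator
            (fun η => G η * ENNReal.ofReal (‖η‖ ^ (-(Module.finrank ℝ E : ℝ) / 4))) η) ∂μ) ^ 2 ∂μ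
      ≤ ENNReal.ofReal C * ((∫⁻ x, F x ^ 2 ∂μ) * ∫⁻ x, G x ^ 2 ∂μ) := by
  refine ⟨μ.real (Metric.ball 0 1), by positivity, fun F G hF hG => ?_⟩
  set w : E → ENNReal := fun ζ => ENNReal.ofReal (‖ζ‖ ^ (-(Module.finrank ℝ E : ℝ) / 4)) with hw
  have hwm : Measurable w := by fun_prop
  have hms : ∀ ξ : E, MeasurableSet {ζ : E | ‖ξ‖ < ‖ζ‖} := fun ξ =>
    measurableSet_lt (by fun_prop) (by fun_prop)
  have hind : ∀ (H : E → ENNReal) (ξ ζ : E), {ζ : E | ‖ξ‖ < ‖ζ‖}.indicator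
      (fun ζ => H ζ * w ζ) ζ ^ 2 = (H ζ * w ζ) ^ 2 * (Metric.ball (0 : E) ‖ζ‖).indicator 1 ξ := by
    intro H ξ ζ
    by_cases h : ‖ξ‖ < ‖ζ‖ <;> simp [h]
  have hmi : Measurable fun p : E × E => (Metric.ball (0 : E) ‖p.2‖).indicator (1 : E → ENNReal) p.1 := by
    have : (fun p : E × E => (Metric.ball (0 : E) ‖p.2‖).indicator (1 : E → ENNReal) p.1)
        = {p : E × E | ‖p.1‖ < ‖p.2‖}.indicator 1 := by
      ext p
      by_cases h : ‖p.1‖ < ‖p.2‖ <;> simp [h]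
    rw [this]
    exact measurable_one.indicator (measurableSet_lt (by fun_prop) (by fun_prop))
  have hmi2 : ∀ ξ, Measurable fun η : E => (Metric.ball (0 : E) ‖η‖).indicator (1 : E → ENNReal) ξ :=
    fun ξ => hmi.comp (by fun_prop : Measurable fun η : E => (ξ, η))
  have hmi1 : ∀ ζ : E, Measurable ((Metric.ball (0 : E) ‖ζ‖).indicator (1 : E → ENNReal)) :=
    fun ζ => measurable_one.indicator measurableSet_ball
  have hball : ∀ ζ η : E, w ζ ^ 2 * w η ^ 2 * (∫⁻ ξ, (Metric.ball (0 : E) ‖ζ‖).indicator 1 ξ *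
      (Metric.ball (0 : E) ‖η‖).indicator 1 ξ ∂μ) ≤ ENNReal.ofReal (μ.real (Metric.ball 0 1)) := by
    intro ζ η
    wlog hle : ‖ζ‖ ≤ ‖η‖ generalizing ζ η
    · simpa only [mul_comm] using this η ζ (not_le.1 hle).le
    have hintg : ∫⁻ ξ, (Metric.ball (0 : E) ‖ζ‖).indicator 1 ξ *
        (Metric.ball (0 : E) ‖η‖).indicator 1 ξ ∂μ ≤ μ (Metric.ball 0 ‖ζ‖) := by
      rw [← lintegral_indicator_one measurableSet_ball]
      refine lintegral_mono fun ξ => mul_le_of_le_one_right' ?_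
      exact Set.indicator_le_self' (by simp) ξ
    refine (mul_le_mul_right hintg _).trans ?_
    rcases eq_or_ne ζ 0 with rfl | hζ
    · simp
    have hζ' : 0 < ‖ζ‖ := norm_pos_iff.2 hζ
    rw [Measure.addHaar_ball_of_pos _ _ hζ', ← mul_assoc, Measure.real,
      ENNReal.ofReal_toReal measure_ball_lt_top.ne]
    refine mul_le_of_le_one_left' ?_
    simp only [hw]
    rw [← ENNReal.ofReal_pow (by positivity), ← ENNReal.ofReal_pow (by positivity),
      ← ENNReal.ofReal_mul (by positivity), ← ENNReal.ofReal_mul (by positivity),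
      ENNReal.ofReal_le_one]
    calc _ ≤ (‖ζ‖ ^ (-(Module.finrank ℝ E : ℝ) / 4)) ^ 2 *
          (‖ζ‖ ^ (-(Module.finrank ℝ E : ℝ) / 4)) ^ 2 * ‖ζ‖ ^ Module.finrank ℝ E := by
          gcongr _ * ?_ ^ 2 * _
          exact Real.rpow_le_rpow_of_nonpos hζ' hle
            (by have : (0 : ℝ) ≤ Module.finrank ℝ E := by positivity
                linarith)
      _ = 1 := by
          rw [← Real.rpow_natCast ‖ζ‖, ← pow_add, ← Real.rpow_mul_natCast hζ'.le,
            ← Real.rpow_add hζ']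
          convert Real.rpow_zero ‖ζ‖ using 2
          push_cast
          ring
  calc _ ≤ ∫⁻ ξ, (∫⁻ ζ, (F ζ * w ζ) ^ 2 * (Metric.ball (0 : E) ‖ζ‖).indicator 1 ξ ∂μ) *
            (∫⁻ η, (G η * w η) ^ 2 * (Metric.ball (0 : E) ‖η‖).indicator 1 ξ ∂μ) ∂μ := by
        refine lintegral_mono fun ξ => ?_
        refine (lintegral_mul_sq_le ?_ ?_).trans ?_
        · exact (((hF.mul hwm).indicator (hms ξ)).comp (by fun_prop : Measurable fun η : E => ξ - η)).aemeasurable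
        · exact ((hG.mul hwm).indicator (hms ξ)).aemeasurable
        · rw [lintegral_sub_left_eq_self (fun ζ => {ζ : E | ‖ξ‖ < ‖ζ‖}.indicator
            (fun ζ => F ζ * w ζ) ζ ^ 2)]
          exact (congrArg₂ (· * ·) (lintegral_congr fun ζ => hind F ξ ζ)
            (lintegral_congr fun η => hind G ξ η)).le
    _ = ∫⁻ ζ, ∫⁻ η, F ζ ^ 2 * G η ^ 2 * (w ζ ^ 2 * w η ^ 2 *
          (∫⁻ ξ, (Metric.ball (0 : E) ‖ζ‖).indicator 1 ξ *
            (Metric.ball (0 : E) ‖η‖).indicator 1 ξ ∂μ)) ∂μ ∂μ := by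
        have hP : Measurable fun p : (E × E) × E =>
            (F p.1.2 * w p.1.2) ^ 2 * (Metric.ball (0 : E) ‖p.1.2‖).indicator 1 p.1.1 *
              ((G p.2 * w p.2) ^ 2 * (Metric.ball (0 : E) ‖p.2‖).indicator 1 p.1.1) := by
          have : Measurable fun p : (E × E) × E =>
              (Metric.ball (0 : E) ‖p.1.2‖).indicator (1 : E → ENNReal) p.1.1 :=
            hmi.comp (by fun_prop : Measurable fun p : (E × E) × E => p.1)
          have : Measurable fun p : (E × E) × E =>
              (Metric.ball (0 : E) ‖p.2‖).indicator (1 : E → ENNReal) p.1.1 :=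
            hmi.comp (by fun_prop : Measurable fun p : (E × E) × E => (p.1.1, p.2))
          fun_prop
        have hsplit : ∀ ξ, (∫⁻ ζ, (F ζ * w ζ) ^ 2 * (Metric.ball (0 : E) ‖ζ‖).indicator 1 ξ ∂μ) *
            (∫⁻ η, (G η * w η) ^ 2 * (Metric.ball (0 : E) ‖η‖).indicator 1 ξ ∂μ) =
            ∫⁻ ζ, ∫⁻ η, (F ζ * w ζ) ^ 2 * (Metric.ball (0 : E) ‖ζ‖).indicator 1 ξ *
              ((G η * w η) ^ 2 * (Metric.ball (0 : E) ‖η‖).indicator 1 ξ) ∂μ ∂μ := fun ξ => by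
          have := hmi2 ξ
          rw [lintegral_lintegral_mul (by fun_prop) (by fun_prop)]
        simp_rw [hsplit]
        rw [lintegral_lintegral_swap hP.lintegral_prod_right'.aemeasurable]
        refine lintegral_congr fun ζ => ?_
        have hPζ : Measurable fun p : E × E =>
            (F ζ * w ζ) ^ 2 * (Metric.ball (0 : E) ‖ζ‖).indicator 1 p.1 *
              ((G p.2 * w p.2) ^ 2 * (Metric.ball (0 : E) ‖p.2‖).indicator 1 p.1) :=
          hP.comp (by fun_prop : Measurable fun p : E × E => ((p.1, ζ), p.2))
        rw [lintegral_lintegral_swap hPζ.aemeasurable]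
        refine lintegral_congr fun η => ?_
        have h1 := hmi1 ζ
        have h2 := hmi1 η
        rw [← lintegral_const_mul _ (by fun_prop), ← lintegral_const_mul _ (by fun_prop)]
        refine lintegral_congr fun ξ => ?_
        ring
    _ ≤ ∫⁻ ζ, ∫⁻ η, F ζ ^ 2 * G η ^ 2 * ENNReal.ofReal (μ.real (Metric.ball 0 1)) ∂μ ∂μ := by
        gcongr with ζ η
        exact hball ζ η
    _ = _ := by
        simp_rw [mul_comm _ (ENNReal.ofReal _)]
        simp_rw [lintegral_const_mul' _ _ ENNReal.ofReal_ne_top]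
        congr 1
        simp_rw [lintegral_const_mul _ (hG.pow_const 2)]
        rw [lintegral_mul_const _ (hF.pow_const 2)]

/-- A bilinear Sobolev-type estimate on the Fourier side: convolution restricted to the region
where the first frequency is dominated by the second one. -/
theorem exists_lintegral_sq_weighted_convolution_le [Nontrivial E] {a b : ℝ} (ha0 : 0 ≤ a)
    (ha : 2 * a < Module.finrank ℝ E) (hab : 2 * a + 2 * b = Module.finrank ℝ E) :
    ∃ C : ℝ, 0 ≤ C ∧ ∀ F G : E → ENNReal, Measurable F → Measurable G →
      ∫⁻ ξ, (∫⁻ η, F (ξ - η) * G η *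
        ({η | ‖ξ - η‖ ≤ ‖η‖}.indicator
          (fun η => ENNReal.ofReal (‖ξ - η‖ ^ (-a) * ‖η‖ ^ (-b))) η) ∂μ) ^ 2 ∂μ
      ≤ ENNReal.ofReal C * ((∫⁻ x, F x ^ 2 ∂μ) * ∫⁻ x, G x ^ 2 ∂μ) := by
  obtain ⟨C₁, hC₁, h₁⟩ := exists_lintegral_sq_lowHigh_le μ ha hab
  obtain ⟨C₂, hC₂, h₂⟩ := exists_lintegral_sq_highHigh_le μ
  refine ⟨2 * (C₁ + (2 ^ a) ^ 2 * C₂), by positivity, fun F G hF hG => ?_⟩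
  set d : ℝ := (Module.finrank ℝ E : ℝ) with hd
  have hmain : ∀ ξ η : E, F (ξ - η) * G η *
        ({η | ‖ξ - η‖ ≤ ‖η‖}.indicator
          (fun η => ENNReal.ofReal (‖ξ - η‖ ^ (-a) * ‖η‖ ^ (-b))) η) ≤
      F (ξ - η) * G η * ({η | ‖ξ - η‖ ≤ ‖η‖ ∧ ‖η‖ ≤ 2 * ‖ξ‖}.indicator
          (fun η => ENNReal.ofReal (‖ξ - η‖ ^ (-a) * ‖η‖ ^ (-b))) η) +
      ENNReal.ofReal (2 ^ a) * (({ζ | ‖ξ‖ < ‖ζ‖}.indicator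
            (fun ζ => F ζ * ENNReal.ofReal (‖ζ‖ ^ (-d / 4))) (ξ - η)) *
        ({η | ‖ξ‖ < ‖η‖}.indicator
            (fun η => G η * ENNReal.ofReal (‖η‖ ^ (-d / 4))) η)) := by
    intro ξ η
    by_cases h : ‖ξ - η‖ ≤ ‖η‖
    swap
    · rw [Set.indicator_of_notMem (by exact h)]
      simp
    by_cases h' : ‖η‖ ≤ 2 * ‖ξ‖
    · rw [Set.indicator_of_mem (by exact h), Set.indicator_of_mem (by exact ⟨h, h'⟩)]
      exact le_self_add
    have htri : ‖η‖ ≤ ‖ξ‖ + ‖ξ - η‖ := by simpa using norm_sub_le ξ (ξ - η)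
    have hξ := norm_nonneg ξ
    rw [Set.indicator_of_mem (by exact h), Set.indicator_of_notMem (by simp [h']),
      Set.indicator_of_mem (s := {ζ | ‖ξ‖ < ‖ζ‖}) (by simp only [Set.mem_ofPred_eq]; linarith),
      Set.indicator_of_mem (s := {ζ | ‖ξ‖ < ‖ζ‖}) (by simp only [Set.mem_ofPred_eq]; linarith),
      mul_zero, zero_add]
    have hζ : 0 < ‖ξ - η‖ := by linarith
    have hη : 0 < ‖η‖ := by linarith
    have hd0 : 0 ≤ d := by positivity
    have hreal : ‖ξ - η‖ ^ (-a) * ‖η‖ ^ (-b) ≤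
        2 ^ a * (‖ξ - η‖ ^ (-d / 4) * ‖η‖ ^ (-d / 4)) := by
      calc ‖ξ - η‖ ^ (-a) * ‖η‖ ^ (-b) ≤ (‖η‖ / 2) ^ (-a) * ‖η‖ ^ (-b) := by
            gcongr ?_ * _
            exact Real.rpow_le_rpow_of_nonpos (by positivity) (by linarith) (by linarith)
        _ = 2 ^ a * (‖η‖ ^ (-d / 4) * ‖η‖ ^ (-d / 4)) := by
            rw [Real.div_rpow hη.le (by norm_num), Real.rpow_neg (by norm_num : (0:ℝ) ≤ 2),
              div_inv_eq_mul, mul_comm _ ((2:ℝ) ^ a), mul_assoc, ← Real.rpow_add hη,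
              ← Real.rpow_add hη]
            congr 2
            linarith
        _ ≤ _ := by
            gcongr _ * (?_ * _)
            exact Real.rpow_le_rpow_of_nonpos hζ h (by linarith)
    calc _ ≤ F (ξ - η) * G η * (ENNReal.ofReal (2 ^ a) *
          (ENNReal.ofReal (‖ξ - η‖ ^ (-d / 4)) * ENNReal.ofReal (‖η‖ ^ (-d / 4)))) := by
          gcongr
          rw [← ENNReal.ofReal_mul (by positivity), ← ENNReal.ofReal_mul (by positivity)]
          exact ENNReal.ofReal_le_ofReal hreal
      _ = _ := by ring
  have hmeas₁ : Measurable fun p : E × E => F (p.1 - p.2) * G p.2 *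
      ({η | ‖p.1 - η‖ ≤ ‖η‖ ∧ ‖η‖ ≤ 2 * ‖p.1‖}.indicator
          (fun η => ENNReal.ofReal (‖p.1 - η‖ ^ (-a) * ‖η‖ ^ (-b))) p.2) := by
    refine Measurable.mul (by fun_prop) ?_
    exact (by fun_prop : Measurable fun p : E × E =>
      ENNReal.ofReal (‖p.1 - p.2‖ ^ (-a) * ‖p.2‖ ^ (-b))).indicator
      ((measurableSet_le (f := fun p : E × E => ‖p.1 - p.2‖) (g := fun p => ‖p.2‖)
        (by fun_prop) (by fun_prop)).inter
      (measurableSet_le (f := fun p : E × E => ‖p.2‖) (g := fun p => 2 * ‖p.1‖)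
        (by fun_prop) (by fun_prop)))
  calc _ ≤ ∫⁻ ξ, (∫⁻ η, (F (ξ - η) * G η * ({η | ‖ξ - η‖ ≤ ‖η‖ ∧ ‖η‖ ≤ 2 * ‖ξ‖}.indicator
          (fun η => ENNReal.ofReal (‖ξ - η‖ ^ (-a) * ‖η‖ ^ (-b))) η) +
        ENNReal.ofReal (2 ^ a) * (({ζ | ‖ξ‖ < ‖ζ‖}.indicator
            (fun ζ => F ζ * ENNReal.ofReal (‖ζ‖ ^ (-d / 4))) (ξ - η)) *
          ({η | ‖ξ‖ < ‖η‖}.indicator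
            (fun η => G η * ENNReal.ofReal (‖η‖ ^ (-d / 4))) η))) ∂μ) ^ 2 ∂μ := by
        gcongr with ξ η
        exact hmain ξ η
    _ ≤ ∫⁻ ξ, 2 * ((∫⁻ η, F (ξ - η) * G η * ({η | ‖ξ - η‖ ≤ ‖η‖ ∧ ‖η‖ ≤ 2 * ‖ξ‖}.indicator
          (fun η => ENNReal.ofReal (‖ξ - η‖ ^ (-a) * ‖η‖ ^ (-b))) η) ∂μ) ^ 2 +
        ENNReal.ofReal ((2 ^ a) ^ 2) * (∫⁻ η, ({ζ | ‖ξ‖ < ‖ζ‖}.indicator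
            (fun ζ => F ζ * ENNReal.ofReal (‖ζ‖ ^ (-d / 4))) (ξ - η)) *
          ({η | ‖ξ‖ < ‖η‖}.indicator
            (fun η => G η * ENNReal.ofReal (‖η‖ ^ (-d / 4))) η) ∂μ) ^ 2) ∂μ := by
        refine lintegral_mono fun ξ => ?_
        have hm : Measurable fun η : E => F (ξ - η) * G η *
            ({η | ‖ξ - η‖ ≤ ‖η‖ ∧ ‖η‖ ≤ 2 * ‖ξ‖}.indicator
              (fun η => ENNReal.ofReal (‖ξ - η‖ ^ (-a) * ‖η‖ ^ (-b))) η) :=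
          hmeas₁.comp (by fun_prop : Measurable fun η : E => (ξ, η))
        rw [lintegral_add_left hm,
          lintegral_const_mul' _ _ ENNReal.ofReal_ne_top, ENNReal.ofReal_pow (by positivity),
          ← mul_pow]
        exact ENNReal.add_sq_le_two_mul _ _
    _ ≤ _ := by
        rw [lintegral_const_mul' _ _ (by simp),
          lintegral_add_left (hmeas₁.lintegral_prod_right'.pow_const 2),
          lintegral_const_mul' _ _ ENNReal.ofReal_ne_top]
        refine (mul_le_mul_right (add_le_add (h₁ F G hF hG)
          (mul_le_mul_right (h₂ F G hF hG) _)) _).trans (le_of_eq ?_)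
        rw [ENNReal.ofReal_mul (by norm_num), ENNReal.ofReal_add hC₁ (by positivity),
          ENNReal.ofReal_mul (by positivity)]
        simp only [ENNReal.ofReal_ofNat]
        ring

end WeightedConvolution

section CommutatorSymbol

theorem abs_rpow_sub_rpow_le {s x y z : ℝ} (hs : 1 ≤ s) (hx : 0 ≤ x) (hy : 0 ≤ y)
    (h : |x - y| ≤ z) : |x ^ s - y ^ s| ≤ s * (y + z) ^ (s - 1) * z := by
  have hz : 0 ≤ z := (abs_nonneg _).trans h
  have hxz : x ≤ y + z := by linarith [(abs_le.1 h).2]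
  have hmvt := Convex.norm_image_sub_le_of_norm_hasDerivWithin_le (𝕜 := ℝ)
    (f := fun t : ℝ => t ^ s) (f' := fun t => s * t ^ (s - 1)) (s := Set.Icc 0 (y + z))
    (C := s * (y + z) ^ (s - 1)) (x := y) (y := x)
    (fun t _ => (Real.hasDerivAt_rpow_const (Or.inr hs)).hasDerivWithinAt)
    (fun t ht => by
      rw [Real.norm_of_nonneg (mul_nonneg (by linarith) (Real.rpow_nonneg ht.1 _))]
      exact mul_le_mul_of_nonneg_left (Real.rpow_le_rpow ht.1 ht.2 (by linarith)) (by linarith))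
    (convex_Icc _ _) ⟨hy, by linarith⟩ ⟨hx, hxz⟩
  simp only [Real.norm_eq_abs] at hmvt
  exact hmvt.trans (mul_le_mul_of_nonneg_left h (by positivity))

/-- The symbol of the commutator when the first frequency is dominated by the second one. -/
theorem mul_abs_rpow_sub_rpow_le_of_le {s x y z : ℝ} (hs : 1 ≤ s) (hx : 0 ≤ x) (hy : 0 ≤ y)
    (h : |x - y| ≤ z) (hzy : z ≤ y) :
    y * |x ^ s - y ^ s| ≤ s * 2 ^ (s - 1) * (z * y ^ s) := by
  have hz : 0 ≤ z := (abs_nonneg _).trans h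
  calc y * |x ^ s - y ^ s| ≤ y * (s * (2 * y) ^ (s - 1) * z) := by
        gcongr
        refine (abs_rpow_sub_rpow_le hs hx hy h).trans ?_
        gcongr
        linarith
    _ = s * 2 ^ (s - 1) * (z * (y ^ (s - 1) * y)) := by
        rw [Real.mul_rpow (by norm_num) hy]; ring
    _ = _ := by
        rcases hy.eq_or_lt with rfl | hy
        · rw [Real.zero_rpow (by linarith : s ≠ 0)]; ring
        · rw [Real.rpow_sub_one hy.ne']; field_simp

/-- The symbol of the commutator when the second frequency is dominated by the first one. -/
theorem mul_abs_rpow_sub_rpow_le_of_ge {s x y z : ℝ} (hs : 1 ≤ s) (hx : 0 ≤ x) (hy : 0 ≤ y)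
    (h : |x - y| ≤ z) (hyz : y ≤ z) :
    y * |x ^ s - y ^ s| ≤ s * 2 ^ (s - 1) * (y * z ^ s) := by
  have hz : 0 ≤ z := (abs_nonneg _).trans h
  calc y * |x ^ s - y ^ s| ≤ y * (s * (2 * z) ^ (s - 1) * z) := by
        gcongr
        refine (abs_rpow_sub_rpow_le hs hx hy h).trans ?_
        gcongr
        linarith
    _ = s * 2 ^ (s - 1) * (y * (z ^ (s - 1) * z)) := by
        rw [Real.mul_rpow (by norm_num) hz]; ring
    _ = _ := by
        rcases hz.eq_or_lt with rfl | hz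
        · rw [Real.zero_rpow (by linarith : s ≠ 0)]; ring
        · rw [Real.rpow_sub_one hz.ne']; field_simp

variable {E : Type*} [NormedAddCommGroup E] [NormedSpace ℝ E] [FiniteDimensional ℝ E]
  [MeasurableSpace E] [BorelSpace E] (μ : Measure E) [μ.IsAddHaarMeasure]

/-- The commutator estimate on the Fourier side. -/
theorem exists_lintegral_sq_commutator_kernel_le [Nontrivial E] {s s₁ s₂ : ℝ} (hs : 1 ≤ s)
    (hs₁ : 1 ≤ s₁) (hs₁' : s₁ < (Module.finrank ℝ E : ℝ) / 2 + 1)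
    (hsum : s₁ + s₂ = s + (Module.finrank ℝ E : ℝ) / 2 + 1) :
    ∃ C : ℝ, 0 ≤ C ∧ ∀ p q : E → ENNReal, Measurable p → Measurable q →
      ∫⁻ ξ, (∫⁻ η, p (ξ - η) * q η * ENNReal.ofReal (‖η‖ * |‖ξ‖ ^ s - ‖η‖ ^ s|) ∂μ) ^ 2 ∂μ
      ≤ ENNReal.ofReal C *
        ((∫⁻ x, (ENNReal.ofReal (‖x‖ ^ s₁) * p x) ^ 2 ∂μ) *
            (∫⁻ x, (ENNReal.ofReal (‖x‖ ^ s₂) * q x) ^ 2 ∂μ) +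
          (∫⁻ x, (ENNReal.ofReal (‖x‖ ^ s₂) * p x) ^ 2 ∂μ) *
            (∫⁻ x, (ENNReal.ofReal (‖x‖ ^ s₁) * q x) ^ 2 ∂μ)) := by
  obtain ⟨C, hC, hCFG⟩ := exists_lintegral_sq_weighted_convolution_le μ (a := s₁ - 1)
    (b := s₂ - s) (by linarith) (by linarith) (by linarith)
  refine ⟨(s * 2 ^ (s - 1)) ^ 2 * 2 * C, by positivity, fun p q hp hq => ?_⟩
  set F : ℝ → (E → ENNReal) → E → ENNReal := fun r p x => ENNReal.ofReal (‖x‖ ^ r) * p x with hF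
  have hFm : ∀ r p, Measurable p → Measurable (F r p) := fun r p hp => by fun_prop
  set k : E → E → ENNReal := fun ξ => {η | ‖ξ - η‖ ≤ ‖η‖}.indicator
    (fun η => ENNReal.ofReal (‖ξ - η‖ ^ (-(s₁ - 1)) * ‖η‖ ^ (-(s₂ - s)))) with hk
  have hkm : Measurable fun p : E × E => k p.1 p.2 :=
    (by fun_prop : Measurable fun p : E × E =>
      ENNReal.ofReal (‖p.1 - p.2‖ ^ (-(s₁ - 1)) * ‖p.2‖ ^ (-(s₂ - s)))).indicator
      (measurableSet_le (f := fun p : E × E => ‖p.1 - p.2‖) (g := fun p => ‖p.2‖)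
        (by fun_prop) (by fun_prop))
  have hpow : ∀ t r c : ℝ, 0 < t → t ^ r * t ^ (-(r - c)) = t ^ c := fun t r c ht => by
    rw [← Real.rpow_add ht]; congr 1; ring
  have hsymm : ∀ ξ η : E, |‖ξ‖ - ‖η‖| ≤ ‖ξ - η‖ := abs_norm_sub_norm_le
  have hker : ∀ ξ η : E, p (ξ - η) * q η * ENNReal.ofReal (‖η‖ * |‖ξ‖ ^ s - ‖η‖ ^ s|) ≤
      ENNReal.ofReal (s * 2 ^ (s - 1)) * (F s₁ p (ξ - η) * F s₂ q η * k ξ η +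
        F s₁ q η * F s₂ p (ξ - η) * k ξ (ξ - η)) := by
    intro ξ η
    have hcore : ENNReal.ofReal (‖η‖ * |‖ξ‖ ^ s - ‖η‖ ^ s|) ≤
        ENNReal.ofReal (s * 2 ^ (s - 1)) *
          (ENNReal.ofReal (‖ξ - η‖ ^ s₁) * ENNReal.ofReal (‖η‖ ^ s₂) * k ξ η +
          ENNReal.ofReal (‖η‖ ^ s₁) * ENNReal.ofReal (‖ξ - η‖ ^ s₂) * k ξ (ξ - η)) := by
      rcases le_total ‖ξ - η‖ ‖η‖ with hle | hle
      · refine le_trans ?_ (mul_le_mul_right le_self_add _)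
        have hb := mul_abs_rpow_sub_rpow_le_of_le hs (norm_nonneg ξ) (norm_nonneg η)
          (hsymm ξ η) hle
        simp only [hk]
        rw [Set.indicator_of_mem (by exact hle), ← ENNReal.ofReal_mul (by positivity),
          ← ENNReal.ofReal_mul (by positivity), ← ENNReal.ofReal_mul (by positivity)]
        refine ENNReal.ofReal_le_ofReal ?_
        rcases (norm_nonneg (ξ - η)).eq_or_lt with h0 | h0
        · rw [← h0] at hb
          refine hb.trans ?_
          rw [zero_mul, mul_zero]
          positivity
        · refine hb.trans_eq ?_
          rw [← hpow ‖η‖ s₂ s (h0.trans_le hle)]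
          nth_rewrite 1 [← Real.rpow_one ‖ξ - η‖, ← hpow ‖ξ - η‖ s₁ 1 h0]
          ring
      · refine le_trans ?_ (mul_le_mul_right le_add_self _)
        have hb := mul_abs_rpow_sub_rpow_le_of_ge hs (norm_nonneg ξ) (norm_nonneg η)
          (hsymm ξ η) hle
        simp only [hk]
        rw [Set.indicator_of_mem (by simpa using hle), ← ENNReal.ofReal_mul (by positivity),
          ← ENNReal.ofReal_mul (by positivity), ← ENNReal.ofReal_mul (by positivity)]
        refine ENNReal.ofReal_le_ofReal ?_
        rw [sub_sub_cancel]
        rcases (norm_nonneg η).eq_or_lt with h0 | h0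
        · rw [← h0] at hb ⊢
          refine hb.trans ?_
          rw [zero_mul, mul_zero]
          positivity
        · refine hb.trans_eq ?_
          rw [← hpow ‖ξ - η‖ s₂ s (h0.trans_le hle)]
          nth_rewrite 1 [← Real.rpow_one ‖η‖, ← hpow ‖η‖ s₁ 1 h0]
          ring
    refine (mul_le_mul_right hcore _).trans_eq ?_
    simp only [hF]
    ring
  have hmeas : ∀ ξ : E, Measurable fun η => F s₁ p (ξ - η) * F s₂ q η * k ξ η := fun ξ => by
    have := hkm.comp (by fun_prop : Measurable fun η : E => (ξ, η))
    simp only [Function.comp_def] at this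
    have h1 := hFm s₁ p hp
    have h2 := hFm s₂ q hq
    fun_prop
  have hmeas' : Measurable fun P : E × E => F s₁ p (P.1 - P.2) * F s₂ q P.2 * k P.1 P.2 := by
    have h1 := hFm s₁ p hp
    have h2 := hFm s₂ q hq
    fun_prop
  calc _ ≤ ∫⁻ ξ, ENNReal.ofReal ((s * 2 ^ (s - 1)) ^ 2 * 2) *
          ((∫⁻ η, F s₁ p (ξ - η) * F s₂ q η * k ξ η ∂μ) ^ 2 +
            (∫⁻ η, F s₁ q (ξ - η) * F s₂ p η * k ξ η ∂μ) ^ 2) ∂μ := by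
        refine lintegral_mono fun ξ => ?_
        have hintg : ∫⁻ η, p (ξ - η) * q η * ENNReal.ofReal (‖η‖ * |‖ξ‖ ^ s - ‖η‖ ^ s|) ∂μ ≤
            ENNReal.ofReal (s * 2 ^ (s - 1)) * ((∫⁻ η, F s₁ p (ξ - η) * F s₂ q η * k ξ η ∂μ) +
            (∫⁻ η, F s₁ q (ξ - η) * F s₂ p η * k ξ η ∂μ)) := by
          refine (lintegral_mono (hker ξ)).trans_eq ?_
          rw [lintegral_const_mul' _ _ ENNReal.ofReal_ne_top, lintegral_add_left (hmeas ξ),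
            ← lintegral_sub_left_eq_self (fun η => F s₁ q (ξ - η) * F s₂ p η * k ξ η) ξ]
          simp only [sub_sub_cancel]
        calc _ ≤ (ENNReal.ofReal (s * 2 ^ (s - 1)) *
              ((∫⁻ η, F s₁ p (ξ - η) * F s₂ q η * k ξ η ∂μ) +
                (∫⁻ η, F s₁ q (ξ - η) * F s₂ p η * k ξ η ∂μ))) ^ 2 := by gcongr
          _ ≤ _ := by
            rw [mul_pow, ENNReal.ofReal_mul (p := (s * 2 ^ (s - 1)) ^ 2) (by positivity),
              ENNReal.ofReal_pow (by positivity), mul_assoc, ENNReal.ofReal_ofNat]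
            gcongr
            exact ENNReal.add_sq_le_two_mul _ _
    _ ≤ _ := by
        rw [lintegral_const_mul' _ _ ENNReal.ofReal_ne_top,
          lintegral_add_left (hmeas'.lintegral_prod_right'.pow_const 2),
          ENNReal.ofReal_mul (q := C) (by positivity), mul_assoc]
        gcongr
        refine (add_le_add (hCFG _ _ (hFm s₁ p hp) (hFm s₂ q hq))
          (hCFG _ _ (hFm s₁ q hq) (hFm s₂ p hp))).trans_eq ?_
        simp only [hF]
        ring

end CommutatorSymbol

section Plancherel

open scoped ContDiff

variable {E : Type*} [NormedAddCommGroup E] [InnerProductSpace ℝ E] [FiniteDimensional ℝ E]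
  [MeasurableSpace E] [BorelSpace E]

/-- The `L²` Fourier transform agrees with the Fourier integral on `L¹ ∩ L²`. -/
theorem coeFn_fourier_toLp_ae_eq {f : E → ℂ} (h₁ : Integrable f) (h₂ : MemLp f 2) :
    (𝓕 (h₂.toLp f) : Lp ℂ 2 (volume : Measure E)) =ᵐ[volume] 𝓕 f := by
  have hcont : Continuous (𝓕 f) :=
    VectorFourier.fourierIntegral_continuous Real.continuous_fourierChar continuous_inner h₁
  refine ae_eq_of_integral_contDiff_smul_eq ((Lp.memLp _).locallyIntegrable (by norm_num))
    hcont.locallyIntegrable fun g hg hgs => ?_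
  have hg₁ : HasCompactSupport (Complex.ofRealCLM ∘ g) := hgs.comp_left rfl
  have hg₂ : ContDiff ℝ ∞ (Complex.ofRealCLM ∘ g) := by fun_prop
  set φ : 𝓢(E, ℂ) := hg₁.toSchwartzMap hg₂ with hφ
  have hφg : ∀ (x : E) (z : ℂ), g x • z = φ x • z := fun x z => by simp [hφ]
  simp_rw [hφg]
  rw [← Lp.toTemperedDistribution_apply, ← Lp.fourier_toTemperedDistribution_eq,
    TemperedDistribution.fourier_apply, Lp.toTemperedDistribution_apply]
  calc _ = ∫ x, 𝓕 φ x • f x := by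
        refine integral_congr_ae ?_
        filter_upwards [h₂.coeFn_toLp] with x hx
        rw [hx]
    _ = _ := by
        simpa using! VectorFourier.integral_fourierIntegral_smul_eq_flip (L := innerₗ E)
          Real.continuous_fourierChar continuous_inner φ.integrable h₁

/-- Plancherel's theorem for the Fourier integral on `L¹ ∩ L²`. -/
theorem eLpNorm_fourier_eq {f : E → ℂ} (h₁ : Integrable f) (h₂ : MemLp f 2) :
    eLpNorm (𝓕 f) 2 = eLpNorm f 2 := by
  rw [← eLpNorm_congr_ae (coeFn_fourier_toLp_ae_eq h₁ h₂), ← Lp.enorm_def, ← ofReal_norm,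
    Lp.norm_fourier_eq, ofReal_norm, Lp.enorm_toLp]

/-- Plancherel's theorem for the inverse Fourier integral on `L¹ ∩ L²`. -/
theorem lintegral_enorm_fourierInv_sq {f : E → ℂ} (h₁ : Integrable f) (h₂ : MemLp f 2) :
    ∫⁻ x, ‖𝓕⁻ f x‖ₑ ^ 2 = ∫⁻ x, ‖f x‖ₑ ^ 2 := by
  have h := congrArg (· ^ 2) (eLpNorm_fourier_eq h₁ h₂)
  have hL : ∀ g : E → ℂ, eLpNorm g 2 ^ 2 = ∫⁻ x, ‖g x‖ₑ ^ 2 := fun g => by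
    have := eLpNorm_nnreal_pow_eq_lintegral (f := g) (μ := volume) (p := 2) (by norm_num)
    simpa using this
  rw [hL, hL] at h
  rw [← h, ← lintegral_neg_eq_self (fun x => ‖𝓕 f x‖ₑ ^ 2)]
  simp_rw [Real.fourierInv_eq_fourier_neg]

end Plancherel

section CommutatorFourier

open scoped LineDeriv ContinuousLinearMap Convolution
open ContinuousLinearMap (mul)

variable {E : Type*} [NormedAddCommGroup E] [InnerProductSpace ℝ E] [FiniteDimensional ℝ E]
  [MeasurableSpace E] [BorelSpace E]

theorem SchwartzMap.integrable_rpow_mul_norm (φ : 𝓢(E, ℂ)) {r : ℝ} (hr : 0 ≤ r) :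
    Integrable fun x : E => ‖x‖ ^ r * ‖φ x‖ := by
  have hcont : Continuous fun x : E => ‖x‖ ^ r * ‖φ x‖ :=
    (continuous_norm.rpow_const fun _ => Or.inr hr).mul φ.continuous.norm
  refine ((φ.integrable_pow_mul volume 0).add (φ.integrable_pow_mul volume ⌈r⌉₊)).mono'
    hcont.aestronglyMeasurable (Eventually.of_forall fun x => ?_)
  rw [Real.norm_of_nonneg (by positivity), Pi.add_apply, ← add_mul]
  gcongr
  rcases le_total ‖x‖ 1 with h | h
  · have := Real.rpow_le_one (norm_nonneg x) h hr
    have : 0 ≤ ‖x‖ ^ ⌈r⌉₊ := by positivity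
    rw [pow_zero]
    linarith
  · have := Real.rpow_le_rpow_of_exponent_le h (Nat.le_ceil r)
    rw [Real.rpow_natCast] at this
    rw [pow_zero]
    linarith

theorem SchwartzMap.integrable_rpow_mul_norm_sq (φ : 𝓢(E, ℂ)) {r : ℝ} (hr : 0 ≤ r) :
    Integrable fun x : E => ‖x‖ ^ r * ‖φ x‖ ^ 2 := by
  have hcont : Continuous fun x : E => ‖x‖ ^ r * ‖φ x‖ ^ 2 :=
    (continuous_norm.rpow_const fun _ => Or.inr hr).mul (φ.continuous.norm.pow 2)
  refine ((φ.integrable_rpow_mul_norm hr).mul_const (SchwartzMap.seminorm ℝ 0 0 φ)).mono'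
    hcont.aestronglyMeasurable (Eventually.of_forall fun x => ?_)
  rw [Real.norm_of_nonneg (by positivity), sq, ← mul_assoc]
  gcongr
  exact φ.norm_le_seminorm ℝ x

theorem SchwartzMap.integrable_rpow_mul (φ : 𝓢(E, ℂ)) {r : ℝ} (hr : 0 ≤ r) :
    Integrable fun x : E => ((‖x‖ ^ r : ℝ) : ℂ) * φ x := by
  have hcont : Continuous fun x : E => ((‖x‖ ^ r : ℝ) : ℂ) * φ x :=
    (Complex.continuous_ofReal.comp (continuous_norm.rpow_const fun _ => Or.inr hr)).mul
      φ.continuous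
  refine (φ.integrable_rpow_mul_norm hr).mono' hcont.aestronglyMeasurable
    (Eventually.of_forall fun x => ?_)
  rw [norm_mul, Complex.norm_real, Real.norm_of_nonneg (by positivity)]

theorem integrable_fourierInv_integrand {f : E → ℂ} (hf : Integrable f) (x : E) :
    Integrable fun v : E => Real.fourierChar (inner ℝ v x) • f v := by
  simpa using (Real.fourierIntegral_convergent_iff (-x)).2 hf

theorem fourierInv_sub_apply {f g : E → ℂ} (hf : Integrable f) (hg : Integrable g) (x : E) :
    𝓕⁻ (fun ξ => f ξ - g ξ) x = 𝓕⁻ f x - 𝓕⁻ g x := by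
  simp only [Real.fourierInv_eq, smul_sub]
  exact integral_sub (integrable_fourierInv_integrand hf x) (integrable_fourierInv_integrand hg x)

theorem fourierInv_sum_apply {ι : Type*} (t : Finset ι) {f : ι → E → ℂ}
    (hf : ∀ i ∈ t, Integrable (f i)) (x : E) :
    𝓕⁻ (fun ξ => ∑ i ∈ t, f i ξ) x = ∑ i ∈ t, 𝓕⁻ (f i) x := by
  simp only [Real.fourierInv_eq, Finset.smul_sum]
  exact integral_finsetSum t fun i hi => integrable_fourierInv_integrand (hf i hi) x

/-- The inverse Fourier transform turns convolutions into products. -/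
theorem fourierInv_mul_convolution_eq {f g : E → ℂ} (hf : Integrable f) (hg : Integrable g)
    (x : E) : 𝓕⁻ (f ⋆[mul ℂ ℂ, volume] g) x = 𝓕⁻ f x * 𝓕⁻ g x := by
  simp only [Real.fourierInv_eq_fourier_neg, Real.fourier_mul_convolution_eq hf hg]

/-- Differentiation of an inverse Fourier transform under the integral sign. -/
theorem fderiv_fourierInv_apply {f : E → ℂ} (hf : Integrable f)
    (hf' : Integrable fun x => ‖x‖ * ‖f x‖) (x v : E) :
    fderiv ℝ (𝓕⁻ f) x v =
      𝓕⁻ (fun ξ => 2 * Real.pi * Complex.I * (inner ℝ ξ v : ℝ) * f ξ) x := by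
  have hg : Integrable fun ξ => f (-ξ) := hf.comp_neg
  have hg' : Integrable fun ξ => ‖ξ‖ * ‖f (-ξ)‖ := by simpa using hf'.comp_neg
  have hI : Integrable (VectorFourier.fourierSMulRight (innerSL ℝ) fun ξ : E => f (-ξ)) := by
    refine (hg'.const_mul (2 * Real.pi * ‖(innerSL ℝ : E →L[ℝ] E →L[ℝ] ℝ)‖)).mono'
      hg.1.fourierSMulRight (Eventually.of_forall fun ξ => ?_)
    refine (VectorFourier.norm_fourierSMulRight_le _ _ _).trans_eq (by ring)
  rw [Real.fourierInv_eq_fourier_comp_neg, (Real.hasFDerivAt_fourier hg hg' x).fderiv,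
    Real.fourier_continuousLinearMap_apply hI, Real.fourierInv_eq_fourier_comp_neg]
  refine congrArg (fun g : E → ℂ => 𝓕 g x) (funext fun ξ => ?_)
  rw [VectorFourier.fourierSMulRight_apply,
    show (innerSL ℝ : E →L[ℝ] E →L[ℝ] ℝ) ξ v = inner ℝ ξ v from rfl]
  simp
  ring

/-- The Fourier transform of a directional derivative. -/
theorem SchwartzMap.fourier_lineDerivOp_apply (b : 𝓢(E, ℂ)) (v ξ : E) :
    𝓕 (∂_{v} b) ξ = 2 * Real.pi * Complex.I * (inner ℝ ξ v : ℝ) * 𝓕 b ξ := by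
  rw [SchwartzMap.fourier_lineDerivOp_eq, smul_apply,
    SchwartzMap.smulLeftCLM_apply_apply (by fun_prop)]
  simp [mul_assoc]

/-- The Fourier transform turns products of Schwartz functions into convolutions. -/
theorem SchwartzMap.fourier_pairing_mul (f g : 𝓢(E, ℂ)) :
    𝓕 (pairing (mul ℂ ℂ) f g) = SchwartzMap.convolution (mul ℂ ℂ) (𝓕 f) (𝓕 g) := by
  have h : 𝓕⁻ (SchwartzMap.convolution (mul ℂ ℂ) (𝓕 f) (𝓕 g)) = pairing (mul ℂ ℂ) f g := by
    ext x
    have hc : ⇑(SchwartzMap.convolution (mul ℂ ℂ) (𝓕 f) (𝓕 g)) =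
        (fun η => 𝓕 f η) ⋆[mul ℂ ℂ, volume] (fun η => 𝓕 g η) := funext fun ξ => SchwartzMap.convolution_apply _ _ _ ξ
    rw [SchwartzMap.fourierInv_coe, hc,
      fourierInv_mul_convolution_eq (𝓕 f).integrable (𝓕 g).integrable,
      ← SchwartzMap.fourierInv_coe, ← SchwartzMap.fourierInv_coe,
      FourierTransform.fourierInv_fourier_eq, FourierTransform.fourierInv_fourier_eq]
    simp [pairing_apply_apply]
  rw [← h, FourierTransform.fourier_fourierInv_eq]

/-- The Fourier transform of the commutator `Λ^s (u ∂_v b) - u ∂_v (Λ^s b)`. -/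
def commutatorFourier (s : ℝ) (u b : 𝓢(E, ℂ)) (v ξ : E) : ℂ :=
  ((‖ξ‖ ^ s : ℝ) : ℂ) * 𝓕 (pairing (mul ℂ ℂ) (∂_{v} b) u) ξ -
    ((fun η => ((‖η‖ ^ s : ℝ) : ℂ) * 𝓕 (∂_{v} b) η) ⋆[mul ℂ ℂ, volume] fun η => 𝓕 u η) ξ

theorem integrable_commutatorFourier {s : ℝ} (hs : 0 ≤ s) (u b : 𝓢(E, ℂ)) (v : E) :
    Integrable (commutatorFourier s u b v) :=
  (SchwartzMap.integrable_rpow_mul _ hs).sub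
    ((SchwartzMap.integrable_rpow_mul (𝓕 (∂_{v} b)) hs).integrable_convolution (mul ℂ ℂ) (𝓕 u).integrable)

theorem fourierInv_commutatorFourier {s : ℝ} (hs : 0 ≤ s) (u b : 𝓢(E, ℂ)) (v x : E) :
    𝓕⁻ (commutatorFourier s u b v) x =
      𝓕⁻ (fun ξ => ((‖ξ‖ ^ s : ℝ) : ℂ) * 𝓕 (pairing (mul ℂ ℂ) (∂_{v} b) u) ξ) x -
        u x * fderiv ℝ (𝓕⁻ fun ξ => ((‖ξ‖ ^ s : ℝ) : ℂ) * 𝓕 b ξ) x v := by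
  have h₁ := SchwartzMap.integrable_rpow_mul (𝓕 (pairing (mul ℂ ℂ) (∂_{v} b) u)) hs
  have h₂ := SchwartzMap.integrable_rpow_mul (𝓕 (∂_{v} b)) hs
  have h₃ : Integrable fun ξ : E => ‖ξ‖ * ‖((‖ξ‖ ^ s : ℝ) : ℂ) * 𝓕 b ξ‖ := by
    refine ((𝓕 b).integrable_rpow_mul_norm (by positivity : 0 ≤ 1 + s)).congr
      (Eventually.of_forall fun ξ => ?_)
    simp only [norm_mul, Complex.norm_real, Real.norm_of_nonneg (Real.rpow_nonneg (norm_nonneg ξ) s)]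
    rw [Real.rpow_add_of_nonneg (norm_nonneg ξ) zero_le_one hs, Real.rpow_one, mul_assoc]
  have hsub : 𝓕⁻ (commutatorFourier s u b v) x =
      𝓕⁻ (fun ξ => ((‖ξ‖ ^ s : ℝ) : ℂ) * 𝓕 (pairing (mul ℂ ℂ) (∂_{v} b) u) ξ) x -
        𝓕⁻ ((fun η => ((‖η‖ ^ s : ℝ) : ℂ) * 𝓕 (∂_{v} b) η) ⋆[mul ℂ ℂ, volume] fun η => 𝓕 u η) x := by
    exact fourierInv_sub_apply h₁ (h₂.integrable_convolution (mul ℂ ℂ) (𝓕 u).integrable) x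
  rw [hsub, fourierInv_mul_convolution_eq h₂ (𝓕 u).integrable,
    fderiv_fourierInv_apply (SchwartzMap.integrable_rpow_mul _ hs) h₃,
    ← SchwartzMap.fourierInv_coe, FourierTransform.fourierInv_fourier_eq, mul_comm]
  congr 2
  refine congrArg (fun g : E → ℂ => 𝓕⁻ g x) (funext fun ξ => ?_)
  rw [SchwartzMap.fourier_lineDerivOp_apply]
  ring

theorem enorm_commutatorFourier_le {s : ℝ} (hs : 0 ≤ s) (u b : 𝓢(E, ℂ)) (v ξ : E) :
    ‖commutatorFourier s u b v ξ‖ₑ ≤ ENNReal.ofReal (2 * Real.pi * ‖v‖) *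
      ∫⁻ η, ‖𝓕 u (ξ - η)‖ₑ * ‖𝓕 b η‖ₑ * ENNReal.ofReal (‖η‖ * |‖ξ‖ ^ s - ‖η‖ ^ s|) := by
  have hI : ∀ f : E → ℂ, Integrable f → Integrable fun η => f η * 𝓕 u (ξ - η) := fun f hf =>
    hf.mul_bdd (c := SchwartzMap.seminorm ℝ 0 0 (𝓕 u))
      ((𝓕 u).continuous.comp (continuous_sub_left ξ)).aestronglyMeasurable
      (Eventually.of_forall fun η => (𝓕 u).norm_le_seminorm ℝ _)
  have h₂ := SchwartzMap.integrable_rpow_mul (𝓕 (∂_{v} b)) hs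
  have hM : commutatorFourier s u b v ξ = ∫ η, (((‖ξ‖ ^ s - ‖η‖ ^ s : ℝ) : ℂ) *
      (2 * Real.pi * Complex.I * (inner ℝ η v : ℝ) * 𝓕 b η)) * 𝓕 u (ξ - η) := by
    simp only [commutatorFourier, SchwartzMap.fourier_pairing_mul, SchwartzMap.convolution_apply,
      MeasureTheory.convolution, ContinuousLinearMap.mul_apply']
    rw [← integral_const_mul, ← integral_sub ((hI _ (𝓕 (∂_{v} b)).integrable).const_mul _)
      (hI _ h₂)]
    refine integral_congr_ae (Eventually.of_forall fun η => ?_)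
    simp only [SchwartzMap.fourier_lineDerivOp_apply]
    push_cast
    ring
  rw [hM, ← lintegral_const_mul' _ _ ENNReal.ofReal_ne_top]
  refine (enorm_integral_le_lintegral_enorm _).trans (lintegral_mono fun η => ?_)
  rw [← ofReal_norm, ← ofReal_norm, ← ofReal_norm, ← ENNReal.ofReal_mul (by positivity),
    ← ENNReal.ofReal_mul (by positivity), ← ENNReal.ofReal_mul (by positivity)]
  apply ENNReal.ofReal_le_ofReal
  simp only [norm_mul, Complex.norm_real, Real.norm_eq_abs, Complex.norm_I, Complex.norm_ofNat,
    abs_of_pos Real.pi_pos]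
  calc _ = 2 * Real.pi * |inner ℝ η v| *
        (‖𝓕 u (ξ - η)‖ * ‖𝓕 b η‖ * |‖ξ‖ ^ s - ‖η‖ ^ s|) := by ring
    _ ≤ 2 * Real.pi * (‖η‖ * ‖v‖) *
        (‖𝓕 u (ξ - η)‖ * ‖𝓕 b η‖ * |‖ξ‖ ^ s - ‖η‖ ^ s|) := by
      gcongr
      exact abs_real_inner_le_norm η v
    _ = _ := by ring

end CommutatorFourier

section CommutatorBound

open scoped LineDeriv
open ContinuousLinearMap (mul)

variable {n : ℕ}

theorem lintegral_rpow_mul_enorm_sq (φ : 𝓢(Ell n, ℂ)) {r : ℝ} (hr : 0 ≤ r) :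
    ∫⁻ ξ, (ENNReal.ofReal (‖ξ‖ ^ r) * ‖𝓕 φ ξ‖ₑ) ^ 2 = ENNReal.ofReal (HsqC r φ) := by
  have hH : HsqC r φ = ∫ ξ, ‖ξ‖ ^ (2 * r) * ‖𝓕 φ ξ‖ ^ 2 := by
    rw [HsqC, SchwartzMap.fourier_coe]
  rw [hH, ofReal_integral_eq_lintegral_ofReal
    ((𝓕 φ).integrable_rpow_mul_norm_sq (by positivity))
    (Eventually.of_forall fun ξ => by positivity)]
  refine lintegral_congr fun ξ => ?_
  rw [← ofReal_norm, ← ENNReal.ofReal_mul (by positivity), ← ENNReal.ofReal_pow (by positivity),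
    mul_pow, mul_comm 2 r, Real.rpow_mul (norm_nonneg ξ), Real.rpow_two]

theorem HsqC_nonneg (r : ℝ) (f : Ell n → ℂ) : 0 ≤ HsqC r f :=
  integral_nonneg fun ξ => by positivity

/-- The `L²` bound for the commutator of `Λ^s` with a single term `u ∂ᵢ`. -/
theorem exists_integral_sq_commutator_le (hn : 1 ≤ n) {s s₁ s₂ : ℝ}
    (hs : 1 ≤ s) (hs₁ : 1 ≤ s₁) (hs₁' : s₁ < (n : ℝ) / 2 + 1)
    (hsum : s₁ + s₂ = s + (n : ℝ) / 2 + 1) :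
    ∃ C : ℝ, 0 ≤ C ∧ ∀ (u b : 𝓢(Ell n, ℂ)) (i : Fin n),
      Integrable (fun x => ‖𝓕⁻ (commutatorFourier s u b (eVec n i)) x‖ ^ 2) ∧
      ∫ x, ‖𝓕⁻ (commutatorFourier s u b (eVec n i)) x‖ ^ 2 ≤
        C * (HsqC s₁ u * HsqC s₂ b + HsqC s₂ u * HsqC s₁ b) := by
  have : NeZero n := ⟨by omega⟩
  obtain ⟨C, hC, hCb⟩ := exists_lintegral_sq_commutator_kernel_le (volume : Measure (Ell n))
    hs hs₁ (by simpa using hs₁') (by simpa using hsum)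
  refine ⟨(2 * Real.pi) ^ 2 * C, by positivity, fun u b i => ?_⟩
  set M := commutatorFourier s u b (eVec n i)
  set R := (2 * Real.pi) ^ 2 * C * (HsqC s₁ u * HsqC s₂ b + HsqC s₂ u * HsqC s₁ b) with hR
  have hH := HsqC_nonneg (n := n)
  have hRnn : 0 ≤ R := by
    have h1 := mul_nonneg (hH s₁ u) (hH s₂ b)
    have h2 := mul_nonneg (hH s₂ u) (hH s₁ b)
    positivity
  have hMi : Integrable M := integrable_commutatorFourier (by linarith) u b _
  have hMle : ∫⁻ ξ, ‖M ξ‖ₑ ^ 2 ≤ ENNReal.ofReal R := by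
    calc ∫⁻ ξ, ‖M ξ‖ₑ ^ 2
        ≤ ∫⁻ ξ, ENNReal.ofReal (2 * Real.pi) ^ 2 * (∫⁻ η, ‖𝓕 u (ξ - η)‖ₑ * ‖𝓕 b η‖ₑ *
            ENNReal.ofReal (‖η‖ * |‖ξ‖ ^ s - ‖η‖ ^ s|)) ^ 2 := by
          refine lintegral_mono fun ξ => ?_
          rw [← mul_pow]
          gcongr
          have := enorm_commutatorFourier_le (zero_le_one.trans hs) u b (eVec n i) ξ
          rwa [show ‖eVec n i‖ = 1 by simp [eVec], mul_one] at this
      _ ≤ ENNReal.ofReal (2 * Real.pi) ^ 2 * (ENNReal.ofReal C *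
            (ENNReal.ofReal (HsqC s₁ u) * ENNReal.ofReal (HsqC s₂ b) +
              ENNReal.ofReal (HsqC s₂ u) * ENNReal.ofReal (HsqC s₁ b))) := by
          rw [lintegral_const_mul' _ _ (by finiteness)]
          gcongr
          refine (hCb (fun x => ‖𝓕 u x‖ₑ) (fun x => ‖𝓕 b x‖ₑ)
            (𝓕 u).continuous.enorm.measurable (𝓕 b).continuous.enorm.measurable).trans_eq ?_
          have h₁ : 0 ≤ s₁ := by linarith
          have h₂ : 0 ≤ s₂ := by linarith
          simp only [lintegral_rpow_mul_enorm_sq _ h₁, lintegral_rpow_mul_enorm_sq _ h₂]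
      _ = ENNReal.ofReal R := by
          rw [← ENNReal.ofReal_mul (hH _ _), ← ENNReal.ofReal_mul (hH _ _),
            ← ENNReal.ofReal_add (mul_nonneg (hH _ _) (hH _ _)) (mul_nonneg (hH _ _) (hH _ _)),
            ← ENNReal.ofReal_mul hC, ← ENNReal.ofReal_pow (by positivity),
            ← ENNReal.ofReal_mul (by positivity), hR, mul_assoc]
  have hM2 : MemLp M 2 := by
    rw [memLp_two_iff_integrable_sq_norm hMi.1]
    refine ⟨hMi.1.norm.pow 2, lt_of_le_of_lt ?_ (ENNReal.ofReal_lt_top (r := R))⟩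
    simpa [enorm_pow] using hMle
  have hcont : Continuous (𝓕⁻ M) := by
    rw [Real.fourierInv_eq_fourier_comp_neg]
    exact VectorFourier.fourierIntegral_continuous Real.continuous_fourierChar continuous_inner
      hMi.comp_neg
  have hle : ∫⁻ x, ‖𝓕⁻ M x‖ₑ ^ 2 ≤ ENNReal.ofReal R :=
    (lintegral_enorm_fourierInv_sq hMi hM2).trans_le hMle
  have hmeas : AEStronglyMeasurable fun x => ‖𝓕⁻ M x‖ ^ 2 :=
    (hcont.norm.pow 2).aestronglyMeasurable
  refine ⟨⟨hmeas, lt_of_le_of_lt ?_ (ENNReal.ofReal_lt_top (r := R))⟩, ?_⟩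
  · simpa [enorm_pow] using hle
  · rw [integral_eq_lintegral_of_nonneg_ae (Eventually.of_forall fun x => by positivity) hmeas]
    refine ENNReal.toReal_le_of_le_ofReal hRnn (le_of_eq_of_le ?_ hle)
    exact lintegral_congr fun x => by rw [ENNReal.ofReal_pow (norm_nonneg _), ofReal_norm]

/-- A real Schwartz function regarded as a complex one. -/
def SchwartzMap.complexify (f : 𝓢(Ell n, ℝ)) : 𝓢(Ell n, ℂ) := f.postcompCLM Complex.ofRealCLM

theorem SchwartzMap.coe_complexify (f : 𝓢(Ell n, ℝ)) : ⇑f.complexify = cf f := rfl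

/-- The commutator is the sum over `i` of the commutators with `uᵢ ∂ᵢ`. -/
theorem Lam_adv_sub_adv_Lam {s : ℝ} (hs : 0 ≤ s) (u B : Fin n → 𝓢(Ell n, ℝ)) (l : Fin n)
    (x : Ell n) :
    Lam s (adv (fun i => cf (u i)) (fun l' => cf (B l')) l) x
        - adv (fun i => cf (u i)) (fun l' => Lam s (cf (B l'))) l x =
      ∑ i, 𝓕⁻ (commutatorFourier s (u i).complexify (B l).complexify (eVec n i)) x := by
  set P : Fin n → 𝓢(Ell n, ℂ) := fun i =>
    pairing (mul ℂ ℂ) (∂_{eVec n i} (B l).complexify) (u i).complexify with hP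
  have hadv : adv (fun i => cf (u i)) (fun l' => cf (B l')) l = ⇑(∑ i, P i) := by
    ext y
    simp only [adv, pd, sum_apply, hP, pairing_apply_apply,
      ContinuousLinearMap.mul_apply', SchwartzMap.lineDerivOp_apply_eq_fderiv,
      SchwartzMap.coe_complexify, mul_comm]
  have hLam : Lam s (adv (fun i => cf (u i)) (fun l' => cf (B l')) l) x =
      ∑ i, 𝓕⁻ (fun ξ => ((‖ξ‖ ^ s : ℝ) : ℂ) * 𝓕 (P i) ξ) x := by
    rw [Lam, hadv, ← SchwartzMap.fourier_coe, FourierTransform.fourier_sum,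
      ← fourierInv_sum_apply _ fun i _ => (𝓕 (P i)).integrable_rpow_mul hs]
    simp only [sum_apply, Finset.mul_sum]
  rw [hLam, adv, ← Finset.sum_sub_distrib]
  refine Finset.sum_congr rfl fun i _ => ?_
  rw [fourierInv_commutatorFourier hs]
  rfl

end CommutatorBound
/-- **Commutator estimate (Proposition 3).** For `s ≥ 1`, `1 ≤ s₁ < n/2 + 1`,
`s₂ > 0` with `s₁ + s₂ = s + n/2 + 1`, there is `c > 0` depending only
on `n, s, s₁, s₂` such that for all Schwartz vector fields `u, B`,
`‖Λ^s[(u·∇)B] − (u·∇)(Λ^s B)‖_{L²} ≤ c(‖u‖_{Ḣ^{s₁}}‖B‖_{Ḣ^{s₂}} + ‖u‖_{Ḣ^{s₂}}‖B‖_{Ḣ^{s₁}})`. -/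
theorem commutator_estimate (n : ℕ) (hn : 1 ≤ n) (s s₁ s₂ : ℝ)
    (hs : 1 ≤ s) (hs₂ : 0 < s₂) (hs₁ : 1 ≤ s₁) (hs₁' : s₁ < (n : ℝ) / 2 + 1)
    (hsum : s₁ + s₂ = s + (n : ℝ) / 2 + 1) :
    ∃ c > (0 : ℝ), ∀ u B : Fin n → 𝓢(Ell n, ℝ),
      vL2 (fun l x =>
          Lam s (adv (fun i => cf (u i)) (fun l' => cf (B l')) l) x
            - adv (fun i => cf (u i)) (fun l' => Lam s (cf (B l'))) l x)
        ≤ c * (Hnorm s₁ (fun l x => u l x) * Hnorm s₂ (fun l x => B l x)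
            + Hnorm s₂ (fun l x => u l x) * Hnorm s₁ (fun l x => B l x)) := by
  obtain ⟨C, hC, hCb⟩ := exists_integral_sq_commutator_le hn hs hs₁ hs₁' hsum
  refine ⟨Real.sqrt (n * C) + 1, by positivity, fun u B => ?_⟩
  have hH := HsqC_nonneg (n := n)
  set K : Fin n → Fin n → Ell n → ℂ := fun l i =>
    𝓕⁻ (commutatorFourier s (u i).complexify (B l).complexify (eVec n i))
  set U : ℝ → ℝ := fun r => ∑ i, HsqC r (cf (u i))
  set W : ℝ → ℝ := fun r => ∑ l, HsqC r (cf (B l))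
  have hU0 : ∀ r, 0 ≤ U r := fun r => Finset.sum_nonneg fun i _ => hH r _
  have hW0 : ∀ r, 0 ≤ W r := fun r => Finset.sum_nonneg fun i _ => hH r _
  have hl : ∀ l, ∫ x, ‖∑ i, K l i x‖ ^ 2 ≤
      n * C * (U s₁ * HsqC s₂ (cf (B l)) + U s₂ * HsqC s₁ (cf (B l))) := fun l => by
    have hintg : Integrable fun x => (n : ℝ) * ∑ i, ‖K l i x‖ ^ 2 :=
      (integrable_finsetSum _ fun i _ => (hCb (u i).complexify (B l).complexify i).1).const_mul _
    calc ∫ x, ‖∑ i, K l i x‖ ^ 2 ≤ ∫ x, (n : ℝ) * ∑ i, ‖K l i x‖ ^ 2 := by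
          refine integral_mono_of_nonneg (Eventually.of_forall fun x => by positivity) hintg
            (Eventually.of_forall fun x => ?_)
          calc ‖∑ i, K l i x‖ ^ 2 ≤ (∑ i, ‖K l i x‖) ^ 2 := by
                gcongr
                exact norm_sum_le _ _
            _ ≤ _ := by
                simpa using sq_sum_le_card_mul_sum_sq (s := Finset.univ)
                  (f := fun i => ‖K l i x‖)
      _ = n * ∑ i, ∫ x, ‖K l i x‖ ^ 2 := by
          rw [integral_const_mul, integral_finsetSum _ fun i _ =>
            (hCb (u i).complexify (B l).complexify i).1]
      _ ≤ n * ∑ i, C * (HsqC s₁ (cf (u i)) * HsqC s₂ (cf (B l)) +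
            HsqC s₂ (cf (u i)) * HsqC s₁ (cf (B l))) := by
          gcongr with i
          exact (hCb (u i).complexify (B l).complexify i).2
      _ = _ := by
          rw [← Finset.mul_sum, Finset.sum_add_distrib, ← Finset.sum_mul, ← Finset.sum_mul,
            mul_assoc]
  have htot : ∑ l, ∫ x, ‖∑ i, K l i x‖ ^ 2 ≤ n * C * (U s₁ * W s₂ + U s₂ * W s₁) := by
    refine (Finset.sum_le_sum fun l _ => hl l).trans_eq ?_
    rw [← Finset.mul_sum, Finset.sum_add_distrib, ← Finset.mul_sum, ← Finset.mul_sum]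
  have hsqrt : Real.sqrt (U s₁ * W s₂ + U s₂ * W s₁) ≤
      Real.sqrt (U s₁) * Real.sqrt (W s₂) + Real.sqrt (U s₂) * Real.sqrt (W s₁) := by
    refine Real.sqrt_le_iff.2 ⟨by positivity, ?_⟩
    rw [add_sq, mul_pow, mul_pow, Real.sq_sqrt (hU0 _), Real.sq_sqrt (hU0 _),
      Real.sq_sqrt (hW0 _), Real.sq_sqrt (hW0 _), add_right_comm]
    exact le_add_of_nonneg_right (by positivity)
  simp only [vL2, Lam_adv_sub_adv_Lam (zero_le_one.trans hs)]
  calc _ ≤ Real.sqrt (n * C * (U s₁ * W s₂ + U s₂ * W s₁)) := Real.sqrt_le_sqrt htot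
    _ = Real.sqrt (n * C) * Real.sqrt (U s₁ * W s₂ + U s₂ * W s₁) :=
        Real.sqrt_mul (by positivity) _
    _ ≤ (Real.sqrt (n * C) + 1) *
          (Real.sqrt (U s₁) * Real.sqrt (W s₂) + Real.sqrt (U s₂) * Real.sqrt (W s₁)) := by
        gcongr
        linarith

end
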